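/- There are absolute constants c* > 0 and C* ≥ 1 such that for every c > 0 there is n₀ ∈ ℕ with the following property for all n ≥ n₀. Let λ satisfy (log n)^{−4} ≤ λ ≤ c*, let d satisfy C*·log n ≤ d ≤ n/C* and dn even, let δ > 0 satisfy λ·δ·d ≥ C*·log n, and set q = 2δ/n. Let K ~ G_d(n) and F ~ G(n,q) be independent. Then with probability at least 1 − c·n^{−14} the following holds: for each U ⊆ [n], if |U| ≤ λn/(10⁶·d) and there is some W ⊆ [n] with |W| ≤ 4|U|/δ and U ⊆ W ∪ N_F(W), then |E_{≥2,K}(U)| ≤ (λ·d/2)·|U|. (Lemma 6.4, with the paper's hypothesis d = o(n) rendered as d ≤ n/C*.) -/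

import Mathlib

open scoped Classical ENNReal

noncomputable section

namespace Sandwich

variable {n : ℕ}

/-- The degree of the vertex `v` in the graph `G`. -/
def deg (G : SimpleGraph (Fin n)) (v : Fin n) : ℕ := Nat.card (G.neighborSet v)

/-- `G` is a `d`-regular graph. -/
def IsRegularGraph (G : SimpleGraph (Fin n)) (d : ℕ) : Prop := ∀ v, deg G v = d

/-- The number of edges of `G`. -/
def edgeCount (G : SimpleGraph (Fin n)) : ℕ := G.edgeSet.ncard

/-- The probability of the event `P` under the probability mass function `μ`. -/
def prEvent {α : Type*} (μ : PMF α) (P : α → Prop) : ℝ≥0∞ := ∑' a, if P a then μ a else 0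

/-- `μ` is the uniform distribution on the set `S`. -/
def IsUniformOn {α : Type*} (μ : PMF α) (S : Set α) : Prop :=
  ∀ a, μ a = if a ∈ S then (S.ncard : ℝ≥0∞)⁻¹ else 0

/-- `P` lists the `k+1` vertices of a `(G₁,G₂)`-alternating path of length `k`: the vertices
are distinct and consecutive vertices are joined by an edge of `G₁` (for steps of even index)
or of `G₂` (for steps of odd index). -/
def IsAltSeq (G₁ G₂ : SimpleGraph (Fin n)) (k : ℕ) (P : Fin (k + 1) → Fin n) : Prop :=
  Function.Injective P ∧
    ∀ i : Fin k, if (i : ℕ) % 2 = 0 then G₁.Adj (P i.castSucc) (P i.succ)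
      else G₂.Adj (P i.castSucc) (P i.succ)

/-- The number of `(G₁,G₂)`-alternating `x,y`-paths of length `k` with no internal vertex
in `Z`. -/
def altPathCount (G₁ G₂ : SimpleGraph (Fin n)) (k : ℕ) (x y : Fin n) (Z : Set (Fin n)) : ℕ :=
  Nat.card {P : Fin (k + 1) → Fin n // IsAltSeq G₁ G₂ k P ∧ P 0 = x ∧ P (Fin.last k) = y ∧
    ∀ i : Fin (k + 1), i ≠ 0 → i ≠ Fin.last k → P i ∉ Z}

/-- The number of `(G₁,G₂)`-alternating paths of length `k` starting at `x`. -/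
def altStartCount (G₁ G₂ : SimpleGraph (Fin n)) (k : ℕ) (x : Fin n) : ℕ :=
  Nat.card {P : Fin (k + 1) → Fin n // IsAltSeq G₁ G₂ k P ∧ P 0 = x}

/-- The external neighbourhood `N_G(U)` of a set of vertices `U`. -/
def nbhd (G : SimpleGraph (Fin n)) (U : Set (Fin n)) : Set (Fin n) :=
  {v | v ∉ U ∧ ∃ u ∈ U, G.Adj u v}

/-- `e_G(U)`, the number of edges of `G` with both endpoints in `U`. -/
def edgesWithin (G : SimpleGraph (Fin n)) (U : Set (Fin n)) : ℕ :=
  {e ∈ G.edgeSet | ∀ v ∈ e, v ∈ U}.ncard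

/-- `e_G(U,V) = |{(u,v) : u ∈ U, v ∈ V, uv ∈ E(G)}|`. -/
def edgesBetween (G : SimpleGraph (Fin n)) (U V : Set (Fin n)) : ℕ :=
  {p : Fin n × Fin n | p.1 ∈ U ∧ p.2 ∈ V ∧ G.Adj p.1 p.2}.ncard

/-- `|E_{≥2,G}(U)|`, the number of edges `xy ∈ E(G)` with `x ∈ U`, `y ∉ U` such that some
`x' ∈ U ∖ {x}` also satisfies `x'y ∈ E(G)`. -/
def E2count (G : SimpleGraph (Fin n)) (U : Set (Fin n)) : ℕ :=
  {e : Sym2 (Fin n) | e ∈ G.edgeSet ∧ ∃ x y, e = s(x, y) ∧ x ∈ U ∧ y ∉ U ∧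
    ∃ x' ∈ U, x' ≠ x ∧ G.Adj x' y}.ncard

/-- `Σ_{u ∈ N_{F∖K}(v)} Σ_{u' ∈ N_K(u)} d_{F∖K}(u')`. -/
def doubleDegSum (F K : SimpleGraph (Fin n)) (v : Fin n) : ℝ :=
  ∑ u : Fin n, if (F \ K).Adj v u then
    ∑ u' : Fin n, if K.Adj u u' then (deg (F \ K) u' : ℝ) else 0
  else 0

/-- `μ` is the law of the binomial random graph `G(n,p)`. -/
def IsGnp (μ : PMF (SimpleGraph (Fin n))) (p : ℝ) : Prop :=
  ∀ G, μ G = ENNReal.ofReal (p ^ edgeCount G * (1 - p) ^ (n.choose 2 - edgeCount G))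

/-- `μ` is the law of `G(n,p)`, where `p` is truncated to `[0,1]` (so that `G(n,p)` is the
empty graph for `p ≤ 0` and the complete graph for `p ≥ 1`). -/
def IsGnpLaw (μ : PMF (SimpleGraph (Fin n))) (p : ℝ) : Prop :=
  IsGnp μ (max 0 (min p 1))

/-- `μ` is the law of `K + E`, where `E` includes each pair not in `E(K)` independently with
probability `p`. -/
def IsAddGnp (μ : PMF (SimpleGraph (Fin n))) (K : SimpleGraph (Fin n)) (p : ℝ) : Prop :=
  ∀ F, μ F = if K ≤ F then
      ENNReal.ofReal (p ^ (edgeCount F - edgeCount K) * (1 - p) ^ (n.choose 2 - edgeCount F))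
    else 0

/-- `ν` is the joint law of `(K, F)` where `K ~ G_d(n)` is a uniformly random `d`-regular graph
and `F = K + E`, `E` including each pair not in `E(K)` independently with probability `p`. -/
def IsRegAddGnp (ν : PMF (SimpleGraph (Fin n) × SimpleGraph (Fin n))) (d : ℕ) (p : ℝ) : Prop :=
  ∀ w, ν w = if IsRegularGraph w.1 d ∧ w.1 ≤ w.2 then
      ({G : SimpleGraph (Fin n) | IsRegularGraph G d}.ncard : ℝ≥0∞)⁻¹ *
        ENNReal.ofReal (p ^ (edgeCount w.2 - edgeCount w.1) *
          (1 - p) ^ (n.choose 2 - edgeCount w.2))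
    else 0

/-- `ν` is the joint law of an independent pair `(K, F)` with `K ~ G_d(n)` and `F ~ G(n,q)`. -/
def IsRegIndepGnp (ν : PMF (SimpleGraph (Fin n) × SimpleGraph (Fin n))) (d : ℕ) (q : ℝ) :
    Prop :=
  ∀ w, ν w = (if IsRegularGraph w.1 d then
      ({G : SimpleGraph (Fin n) | IsRegularGraph G d}.ncard : ℝ≥0∞)⁻¹ else 0) *
      ENNReal.ofReal (q ^ edgeCount w.2 * (1 - q) ^ (n.choose 2 - edgeCount w.2))


/-! ### Switchings in regular graphs -/

/-- The graph obtained from `K` by exchanging the edges `xy, ab` for `xa, yb`. -/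
def switch (K : SimpleGraph (Fin n)) (x y a b : Fin n) : SimpleGraph (Fin n) :=
  SimpleGraph.fromEdgeSet ((K.edgeSet \ {s(x, y), s(a, b)}) ∪ {s(x, a), s(y, b)})

/-- The edges `xy, ab` of `K` can be exchanged for the pairs `xa, yb`. -/
structure Switchable (K : SimpleGraph (Fin n)) (x y a b : Fin n) : Prop where
  hxy : K.Adj x y
  hab : K.Adj a b
  hxa : ¬ K.Adj x a
  hyb : ¬ K.Adj y b
  hax : a ≠ x
  hby : b ≠ y

lemma deg_eq_card (G : SimpleGraph (Fin n)) (v : Fin n) :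
    deg G v = (Finset.univ.filter (G.Adj v)).card := by
  rw [deg, Nat.card_eq_card_toFinset]
  congr 1
  ext u
  simp

lemma deg_eq_sum (G : SimpleGraph (Fin n)) (v : Fin n) :
    (deg G v : ℤ) = ∑ u, if G.Adj v u then 1 else 0 := by
  rw [deg_eq_card, Finset.card_filter]
  push_cast
  rfl

lemma sum_ite_mk_eq {x y : Fin n} (h : x ≠ y) (v : Fin n) :
    (∑ u, if s(v, u) = s(x, y) then (1 : ℤ) else 0) =
      (if v = x then 1 else 0) + (if v = y then 1 else 0) := by
  have key : ∀ u, (if s(v, u) = s(x, y) then (1 : ℤ) else 0) =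
      (if u = y then (if v = x then 1 else 0) else 0) +
        (if u = x then (if v = y then 1 else 0) else 0) := by
    intro u
    simp only [Sym2.eq_iff]
    split_ifs <;> grind
  simp only [key, Finset.sum_add_distrib, Finset.sum_ite_eq', Finset.mem_univ, if_true]

namespace Switchable

variable {K : SimpleGraph (Fin n)} {x y a b : Fin n}

lemma distinct (h : Switchable K x y a b) : x ≠ y ∧ a ≠ b ∧ a ≠ y ∧ b ≠ x := by
  refine ⟨h.hxy.ne, h.hab.ne, ?_, ?_⟩
  · rintro rfl
    exact h.hxa h.hxy
  · rintro rfl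
    exact h.hyb h.hxy.symm

lemma adj_iff (h : Switchable K x y a b) (v u : Fin n) :
    (switch K x y a b).Adj v u ↔
      (K.Adj v u ∧ s(v, u) ≠ s(x, y) ∧ s(v, u) ≠ s(a, b)) ∨
        s(v, u) = s(x, a) ∨ s(v, u) = s(y, b) := by
  obtain ⟨h1, h2, h3, h4⟩ := h.distinct
  have h5 := h.hax
  have h6 := h.hby
  have h7 : K.Adj v u → v ≠ u := fun h => h.ne
  simp only [switch, SimpleGraph.fromEdgeSet_adj, Set.mem_union, Set.mem_sdiff,
    SimpleGraph.mem_edgeSet, Set.mem_insert_iff, Set.mem_singleton_iff, Sym2.eq_iff]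
  grind

lemma regular (h : Switchable K x y a b) {d : ℕ} (hK : IsRegularGraph K d) :
    IsRegularGraph (switch K x y a b) d := by
  intro v
  obtain ⟨h1, h2, h3, h4⟩ := h.distinct
  have key : ∀ u, (if (switch K x y a b).Adj v u then (1 : ℤ) else 0) =
      (if K.Adj v u then 1 else 0) - (if s(v, u) = s(x, y) then 1 else 0)
        - (if s(v, u) = s(a, b) then 1 else 0) + (if s(v, u) = s(x, a) then 1 else 0)
        + (if s(v, u) = s(y, b) then 1 else 0) := by
    intro u
    have e1 : s(v, u) = s(x, y) → K.Adj v u := fun e => by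
      rw [← SimpleGraph.mem_edgeSet, e]; exact h.hxy
    have e2 : s(v, u) = s(a, b) → K.Adj v u := fun e => by
      rw [← SimpleGraph.mem_edgeSet, e]; exact h.hab
    have e3 : s(v, u) = s(x, a) → ¬ K.Adj v u := fun e => by
      rw [← SimpleGraph.mem_edgeSet, e]; exact h.hxa
    have e4 : s(v, u) = s(y, b) → ¬ K.Adj v u := fun e => by
      rw [← SimpleGraph.mem_edgeSet, e]; exact h.hyb
    have e5 : s(x, y) ≠ s(a, b) := by
      have := h.hax
      simp only [ne_eq, Sym2.eq_iff]; grind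
    have e6 : s(x, a) ≠ s(y, b) := by
      simp only [ne_eq, Sym2.eq_iff]; grind
    simp only [h.adj_iff]
    split_ifs <;> grind
  have hd := deg_eq_sum K v
  have hd' := deg_eq_sum (switch K x y a b) v
  simp only [key, Finset.sum_add_distrib, Finset.sum_sub_distrib, sum_ite_mk_eq h1,
    sum_ite_mk_eq h2, sum_ite_mk_eq h.hax.symm, sum_ite_mk_eq h.hby.symm] at hd'
  rw [← hd, hK v] at hd'
  have : (deg (switch K x y a b) v : ℤ) = d := by rw [hd']; ring
  exact_mod_cast this

lemma switch_switch (h : Switchable K x y a b) :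
    switch (switch K x y a b) x a y b = K := by
  obtain ⟨h1, h2, h3, h4⟩ := h.distinct
  have hs : Switchable (switch K x y a b) x a y b := by
    constructor
    · rw [h.adj_iff]; simp
    · rw [h.adj_iff]; simp
    · rw [h.adj_iff]; have := h.hby; have := h.hax; simp only [Sym2.eq_iff]; grind
    · rw [h.adj_iff]; have := h.hby; have := h.hax; simp only [Sym2.eq_iff]; grind
    · exact h1.symm
    · exact h2.symm
  ext v u
  have e1 : s(v, u) = s(x, y) → K.Adj v u := fun e => by
    rw [← SimpleGraph.mem_edgeSet, e]; exact h.hxy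
  have e2 : s(v, u) = s(a, b) → K.Adj v u := fun e => by
    rw [← SimpleGraph.mem_edgeSet, e]; exact h.hab
  have e3 : s(v, u) = s(x, a) → ¬ K.Adj v u := fun e => by
    rw [← SimpleGraph.mem_edgeSet, e]; exact h.hxa
  have e4 : s(v, u) = s(y, b) → ¬ K.Adj v u := fun e => by
    rw [← SimpleGraph.mem_edgeSet, e]; exact h.hyb
  rw [hs.adj_iff, h.adj_iff]
  tauto

end Switchable

/-- The `d`-regular graphs on `[n]` containing all the edges in `E`. -/
def regularContaining (n d : ℕ) (E : Finset (Sym2 (Fin n))) : Finset (SimpleGraph (Fin n)) :=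
  Finset.univ.filter fun K => IsRegularGraph K d ∧ ∀ e ∈ E, e ∈ K.edgeSet

/-- The oriented edges `(a, b)` along which `xy` can be switched without destroying `E`. -/
def switchPartners (K : SimpleGraph (Fin n)) (E : Finset (Sym2 (Fin n))) (x y : Fin n) :
    Finset (Fin n × Fin n) :=
  Finset.univ.filter fun p => Switchable K x y p.1 p.2 ∧ s(p.1, p.2) ∉ E

lemma card_adj_pairs {K : SimpleGraph (Fin n)} {d : ℕ} (hK : IsRegularGraph K d)
    (A : Finset (Fin n)) :
    (Finset.univ.filter fun p : Fin n × Fin n => p.1 ∈ A ∧ K.Adj p.1 p.2).card = A.card * d := by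
  have : (Finset.univ.filter fun p : Fin n × Fin n => p.1 ∈ A ∧ K.Adj p.1 p.2) =
      (A.sigma fun a => Finset.univ.filter (K.Adj a)).map
        (Equiv.sigmaEquivProd _ _).toEmbedding := by
    ext ⟨a, b⟩
    simp
  rw [this, Finset.card_map, Finset.card_sigma]
  rw [Finset.sum_congr rfl fun v _ => (deg_eq_card K v).symm.trans (hK v), Finset.sum_const,
    smul_eq_mul]

lemma card_orient_le (E : Finset (Sym2 (Fin n))) :
    (Finset.univ.filter fun p : Fin n × Fin n => s(p.1, p.2) ∈ E).card ≤ 2 * E.card := by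
  have h : (Finset.univ.filter fun p : Fin n × Fin n => s(p.1, p.2) ∈ E).card ≤
      ∑ e ∈ E, 2 := by
    rw [Finset.card_eq_sum_card_fiberwise (f := fun p : Fin n × Fin n => s(p.1, p.2)) (t := E)]
    · refine Finset.sum_le_sum fun e _ => ?_
      induction e using Sym2.ind with
      | _ x y =>
        refine (Finset.card_le_card (t := {(x, y), (y, x)}) ?_).trans Finset.card_le_two
        rintro ⟨a, b⟩ hp
        simp only [Finset.mem_filter, Sym2.eq_iff] at hp
        simp only [Finset.mem_insert, Finset.mem_singleton, Prod.mk.injEq]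
        exact hp.2
    · intro p hp
      simpa using hp
  simpa [mul_comm] using h

lemma card_switchPartners {K : SimpleGraph (Fin n)} {d : ℕ} (hK : IsRegularGraph K d)
    (E : Finset (Sym2 (Fin n))) {x y : Fin n} (hxy : K.Adj x y) :
    n * d ≤ (switchPartners K E x y).card + 2 * E.card + 2 * ((d + 1) * d) := by
  have h0 := card_adj_pairs hK Finset.univ
  have hx := card_adj_pairs hK (insert x (Finset.univ.filter (K.Adj x)))
  have hy := card_adj_pairs hK (insert y (Finset.univ.filter (K.Adj y)))
  rw [Finset.card_insert_of_notMem (by simp), ← deg_eq_card, hK] at hx hy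
  have hE := card_orient_le E
  set A := Finset.univ.filter fun p : Fin n × Fin n => p.1 ∈ Finset.univ ∧ K.Adj p.1 p.2
  set B := Finset.univ.filter fun p : Fin n × Fin n =>
    p.1 ∈ insert x (Finset.univ.filter (K.Adj x)) ∧ K.Adj p.1 p.2
  set C := Finset.univ.filter fun p : Fin n × Fin n =>
    p.1 ∈ insert y (Finset.univ.filter (K.Adj y)) ∧ K.Adj p.1 p.2
  set D := Finset.univ.filter fun p : Fin n × Fin n => s(p.1, p.2) ∈ E
  have hsub : A ⊆ ((switchPartners K E x y ∪ D) ∪ B) ∪ C.image Prod.swap := by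
    rintro ⟨a, b⟩ hp
    simp only [A, B, C, D, switchPartners, Finset.mem_filter, Finset.mem_univ, true_and,
      Finset.mem_union, Finset.mem_image, Prod.exists, Finset.mem_insert, Prod.swap_prod_mk,
      Prod.mk.injEq] at hp ⊢
    by_cases h1 : s(a, b) ∈ E
    · tauto
    by_cases h2 : a = x ∨ K.Adj x a
    · tauto
    by_cases h3 : b = y ∨ K.Adj y b
    · exact Or.inr ⟨b, a, ⟨h3, hp.symm⟩, rfl, rfl⟩
    push Not at h2 h3
    exact Or.inl (Or.inl (Or.inl ⟨⟨hxy, hp, h2.2, h3.2, h2.1, h3.1⟩, h1⟩))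
  have hc := Finset.card_le_card hsub
  have u1 := Finset.card_union_le ((switchPartners K E x y ∪ D) ∪ B) (C.image Prod.swap)
  have u2 := Finset.card_union_le (switchPartners K E x y ∪ D) B
  have u3 := Finset.card_union_le (switchPartners K E x y) D
  have u4 : (C.image Prod.swap).card ≤ C.card := Finset.card_image_le
  simp only [Finset.card_univ, Fintype.card_fin] at h0
  omega

lemma card_regularContaining_insert {d : ℕ} {E : Finset (Sym2 (Fin n))} {e : Sym2 (Fin n)}
    (he : e ∉ E) (hd : 8 * (d + 1) ≤ n) (hE : 16 * E.card ≤ n * d) :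
    (regularContaining n d (insert e E)).card * n ≤ 2 * d * (regularContaining n d E).card := by
  induction e using Sym2.ind with
  | _ x y =>
  rcases Nat.eq_zero_or_pos d with rfl | hdpos
  · have : regularContaining n 0 (insert s(x, y) E) = ∅ := by
      refine Finset.filter_false_of_mem fun K _ => ?_
      rintro ⟨hK, h⟩
      have hadj : K.Adj x y := h _ (Finset.mem_insert_self _ _)
      have := hK x
      rw [deg_eq_card, Finset.card_eq_zero] at this
      have hy : y ∈ Finset.univ.filter (K.Adj x) := by simpa using hadj
      rw [this] at hy
      simp at hy
    simp [this]
  have hadj : ∀ K ∈ regularContaining n d (insert s(x, y) E),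
      IsRegularGraph K d ∧ K.Adj x y ∧ ∀ e ∈ E, e ∈ K.edgeSet := by
    intro K hK
    simp only [regularContaining, Finset.mem_filter, Finset.mem_univ, true_and,
      Finset.mem_insert, forall_eq_or_imp, SimpleGraph.mem_edgeSet] at hK
    exact hK
  have lower : (regularContaining n d (insert s(x, y) E)).card * (n * d) ≤
      2 * ((regularContaining n d (insert s(x, y) E)).sigma
        fun K => switchPartners K E x y).card := by
    rw [Finset.card_sigma, Finset.mul_sum, ← smul_eq_mul, ← Finset.sum_const]
    refine Finset.sum_le_sum fun K hK => ?_
    obtain ⟨h1, h2, -⟩ := hadj K hK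
    have := card_switchPartners h1 E h2
    nlinarith
  have upper : ((regularContaining n d (insert s(x, y) E)).sigma
        fun K => switchPartners K E x y).card ≤
      ((regularContaining n d E).sigma fun K =>
        (Finset.univ.filter (K.Adj x)) ×ˢ (Finset.univ.filter (K.Adj y))).card := by
    refine Finset.card_le_card_of_injOn
      (fun q => ⟨switch q.1 x y q.2.1 q.2.2, q.2⟩) ?_ ?_
    · rintro ⟨K, a, b⟩ hq
      simp only [Finset.coe_sigma, Set.mem_sigma_iff, Finset.mem_coe] at hq
      obtain ⟨hK, hp⟩ := hq
      obtain ⟨h1, h2, h3⟩ := hadj K hK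
      simp only [switchPartners, Finset.mem_filter, Finset.mem_univ, true_and] at hp
      obtain ⟨hs, hab⟩ := hp
      simp only [Finset.coe_sigma, Set.mem_sigma_iff, Finset.mem_coe, Finset.mem_product,
        Finset.mem_filter, Finset.mem_univ, true_and, regularContaining, hs.adj_iff]
      refine ⟨⟨hs.regular h1, fun e heE => ?_⟩, by simp, by simp⟩
      induction e using Sym2.ind with
      | _ v u =>
        rw [SimpleGraph.mem_edgeSet, hs.adj_iff]
        exact Or.inl ⟨h3 _ heE, fun h => he (h ▸ heE), fun h => hab (h ▸ heE)⟩
    · rintro ⟨K, a, b⟩ hq ⟨K', a', b'⟩ hq' heq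
      simp only [Finset.coe_sigma, Set.mem_sigma_iff, Finset.mem_coe, switchPartners,
        Finset.mem_filter, Finset.mem_univ, true_and] at hq hq'
      simp only [Sigma.mk.injEq, heq_eq_eq, Prod.mk.injEq] at heq
      obtain ⟨h1, rfl, rfl⟩ := heq
      have : K = K' := by
        rw [← hq.2.1.switch_switch, h1, hq'.2.1.switch_switch]
      rw [this]
  have count : ((regularContaining n d E).sigma fun K =>
        (Finset.univ.filter (K.Adj x)) ×ˢ (Finset.univ.filter (K.Adj y))).card =
      (regularContaining n d E).card * (d * d) := by
    rw [Finset.card_sigma, ← smul_eq_mul, ← Finset.sum_const]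
    refine Finset.sum_congr rfl fun K hK => ?_
    simp only [regularContaining, Finset.mem_filter, Finset.mem_univ, true_and] at hK
    rw [Finset.card_product, ← deg_eq_card, ← deg_eq_card, hK.1, hK.1]
  rw [count] at upper
  refine Nat.le_of_mul_le_mul_right (c := d) ?_ hdpos
  nlinarith

lemma card_regularContaining {d : ℕ} (hd : 8 * (d + 1) ≤ n) (E : Finset (Sym2 (Fin n)))
    (hE : 16 * E.card ≤ n * d) :
    (regularContaining n d E).card * n ^ E.card ≤
      (2 * d) ^ E.card * (regularContaining n d ∅).card := by
  induction E using Finset.induction_on with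
  | empty => simp
  | insert e E he ih =>
    rw [Finset.card_insert_of_notMem he] at hE ⊢
    have h1 := card_regularContaining_insert he hd (by omega)
    have h2 := ih (by omega)
    calc _ = (regularContaining n d (insert e E)).card * n * n ^ E.card := by ring
      _ ≤ 2 * d * (regularContaining n d E).card * n ^ E.card := by gcongr
      _ = 2 * d * ((regularContaining n d E).card * n ^ E.card) := by ring
      _ ≤ 2 * d * ((2 * d) ^ E.card * (regularContaining n d ∅).card) := by gcongr
      _ = _ := by ring

/-! ### Containment probabilities in binomial random graphs -/

/-- The probability of the graph `F` in `G(n,q)`. -/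
def gnpWeight (q : ℝ) (F : SimpleGraph (Fin n)) : ℝ :=
  q ^ edgeCount F * (1 - q) ^ (n.choose 2 - edgeCount F)

lemma edgeCount_eq (F : SimpleGraph (Fin n)) : edgeCount F = F.edgeFinset.card := by
  rw [edgeCount, ← SimpleGraph.coe_edgeFinset, Set.ncard_coe_finset]

lemma gnpWeight_nonneg {q : ℝ} (h0 : 0 ≤ q) (h1 : q ≤ 1) (F : SimpleGraph (Fin n)) :
    0 ≤ gnpWeight q F :=
  mul_nonneg (pow_nonneg h0 _) (pow_nonneg (by linarith) _)

lemma sum_gnpWeight_contains_le {q : ℝ} (h0 : 0 ≤ q) (h1 : q ≤ 1) (E : Finset (Sym2 (Fin n))) :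
    ∑ F : SimpleGraph (Fin n) with ∀ e ∈ E, e ∈ F.edgeSet, gnpWeight q F ≤ q ^ E.card := by
  by_cases hE : E ⊆ (⊤ : SimpleGraph (Fin n)).edgeFinset
  swap
  · rw [Finset.filter_false_of_mem, Finset.sum_empty]
    · positivity
    · intro F _ h
      refine hE fun e he => ?_
      rw [SimpleGraph.mem_edgeFinset]
      exact SimpleGraph.edgeSet_mono le_top (h e he)
  set T := (⊤ : SimpleGraph (Fin n)).edgeFinset
  have hT : T.card = n.choose 2 := by
    rw [SimpleGraph.card_edgeFinset_top_eq_card_choose_two, Fintype.card_fin]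
  have hbin := Finset.sum_pow_mul_eq_add_pow q (1 - q) (T \ E)
  rw [show q + (1 - q) = 1 by ring, one_pow] at hbin
  calc ∑ F : SimpleGraph (Fin n) with ∀ e ∈ E, e ∈ F.edgeSet, gnpWeight q F
      = ∑ F : SimpleGraph (Fin n) with ∀ e ∈ E, e ∈ F.edgeSet,
          q ^ E.card * (q ^ (F.edgeFinset \ E).card *
            (1 - q) ^ ((T \ E).card - (F.edgeFinset \ E).card)) := by
        refine Finset.sum_congr rfl fun F hF => ?_
        have hEF : E ⊆ F.edgeFinset := fun e he => by
          simpa using (Finset.mem_filter.1 hF).2 e he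
        have hc := Finset.card_le_card hEF
        rw [gnpWeight, edgeCount_eq, ← mul_assoc, ← pow_add, Finset.card_sdiff_of_subset hE,
          Finset.card_sdiff_of_subset hEF, hT, Nat.add_sub_cancel' hc, Nat.sub_sub,
          Nat.add_sub_cancel' hc]
    _ = ∑ t ∈ (Finset.univ.filter fun F : SimpleGraph (Fin n) =>
          ∀ e ∈ E, e ∈ F.edgeSet).image (fun F => F.edgeFinset \ E),
          q ^ E.card * (q ^ t.card * (1 - q) ^ ((T \ E).card - t.card)) := by
        rw [Finset.sum_image]
        intro F hF F' hF' h
        have hEF : E ⊆ F.edgeFinset := fun e he => by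
          simpa using (Finset.mem_filter.1 hF).2 e he
        have hEF' : E ⊆ F'.edgeFinset := fun e he => by
          simpa using (Finset.mem_filter.1 hF').2 e he
        have h' : F.edgeFinset = F'.edgeFinset := by
          rw [← Finset.sdiff_union_of_subset hEF, ← Finset.sdiff_union_of_subset hEF']
          simp only at h
          rw [h]
        exact SimpleGraph.edgeFinset_inj.1 h'
    _ ≤ ∑ t ∈ (T \ E).powerset,
          q ^ E.card * (q ^ t.card * (1 - q) ^ ((T \ E).card - t.card)) := by
        refine Finset.sum_le_sum_of_subset_of_nonneg ?_ fun t _ _ => ?_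
        · intro t ht
          obtain ⟨F, -, rfl⟩ := Finset.mem_image.1 ht
          rw [Finset.mem_powerset]
          exact Finset.sdiff_subset_sdiff (SimpleGraph.edgeFinset_mono le_top) le_rfl
        · have : 0 ≤ 1 - q := by linarith
          positivity
    _ = q ^ E.card := by rw [← Finset.mul_sum, hbin, mul_one]

lemma sum_biUnion_le {ι α : Type*} [DecidableEq α] (s : Finset ι) (t : ι → Finset α) {f : α → ℝ}
    (hf : ∀ a, 0 ≤ f a) : ∑ a ∈ s.biUnion t, f a ≤ ∑ i ∈ s, ∑ a ∈ t i, f a := by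
  induction s using Finset.induction_on with
  | empty => simp
  | insert i s hi ih =>
    rw [Finset.biUnion_insert, Finset.sum_insert hi]
    have h := Finset.sum_union_inter (s₁ := t i) (s₂ := s.biUnion t) (f := f)
    have h' : 0 ≤ ∑ a ∈ t i ∩ s.biUnion t, f a := Finset.sum_nonneg fun a _ => hf a
    linarith

/-- The probability that `S ⊆ W ∪ N(W)` in `G(n,q)` is at most `(|W|q)^{|S∖W|}`. -/
lemma sum_gnpWeight_covers_le {q : ℝ} (h0 : 0 ≤ q) (h1 : q ≤ 1) (W S : Finset (Fin n)) :
    ∑ F : SimpleGraph (Fin n) with (S : Set (Fin n)) ⊆ W ∪ nbhd F W, gnpWeight q F ≤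
      ∏ v ∈ S, if v ∈ W then 1 else W.card * q := by
  have hcount : ∏ v ∈ S, (if v ∈ W then 1 else W.card * q) =
      ∑ _g ∈ Fintype.piFinset (fun _ : {v // v ∈ S \ W} => W), q ^ (S \ W).card := by
    rw [Finset.sum_const, Fintype.card_piFinset, Finset.prod_const, Finset.card_univ,
      Fintype.card_coe, nsmul_eq_mul, Finset.prod_ite, Finset.prod_const_one, one_mul,
      Finset.prod_const, mul_pow, Nat.cast_pow, Finset.sdiff_eq_filter]
  rw [hcount]
  set edges : ({v // v ∈ S \ W} → Fin n) → Finset (Sym2 (Fin n)) :=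
    fun g => Finset.univ.image fun v => s(v.1, g v) with hedges
  have hcard : ∀ g ∈ Fintype.piFinset (fun _ : {v // v ∈ S \ W} => W),
      (edges g).card = (S \ W).card := by
    intro g hg
    rw [hedges, Finset.card_image_of_injective, Finset.card_univ, Fintype.card_coe]
    intro v v' h
    rw [Fintype.mem_piFinset] at hg
    have hv := (Finset.mem_sdiff.1 v.2).2
    simp only [Sym2.eq_iff] at h
    rcases h with h | h
    · exact Subtype.ext h.1
    · exact absurd (h.1 ▸ hg v') hv
  calc _ ≤ ∑ F ∈ (Fintype.piFinset (fun _ : {v // v ∈ S \ W} => W)).biUnion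
        (fun g => Finset.univ.filter fun F : SimpleGraph (Fin n) =>
          ∀ e ∈ edges g, e ∈ F.edgeSet), gnpWeight q F := by
        refine Finset.sum_le_sum_of_subset_of_nonneg ?_ fun F _ _ => gnpWeight_nonneg h0 h1 F
        intro F hF
        rw [Finset.mem_filter] at hF
        have hex : ∀ v : {v // v ∈ S \ W}, ∃ w ∈ W, F.Adj w v := by
          rintro ⟨v, hv⟩
          rw [Finset.mem_sdiff] at hv
          rcases hF.2 (Finset.mem_coe.2 hv.1) with h | h
          · exact absurd h hv.2
          · exact h.2
        choose g hgW hg using hex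
        refine Finset.mem_biUnion.2 ⟨g, Fintype.mem_piFinset.2 hgW, ?_⟩
        simp only [hedges, Finset.mem_filter, Finset.mem_univ, true_and, Finset.mem_image,
          forall_exists_index]
        rintro _ v rfl
        exact (hg v).symm
    _ ≤ ∑ g ∈ Fintype.piFinset (fun _ : {v // v ∈ S \ W} => W),
        ∑ F : SimpleGraph (Fin n) with ∀ e ∈ edges g, e ∈ F.edgeSet, gnpWeight q F := 
        sum_biUnion_le _ _ fun F => gnpWeight_nonneg h0 h1 F
    _ ≤ _ := by
        refine Finset.sum_le_sum fun g hg => ?_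
        rw [← hcard g hg]
        exact sum_gnpWeight_contains_le h0 h1 _

/-- The sum of `∏_{v ∈ S} p_v` over `j`-sets `S` is at most `z^{-j} exp(z ∑ p_v)`. -/
lemma pow_mul_sum_powersetCard_prod_le {α : Type*} [Fintype α] {p : α → ℝ}
    (hp : ∀ v, 0 ≤ p v) {z : ℝ} (hz : 0 ≤ z) (j : ℕ) :
    z ^ j * ∑ S ∈ Finset.powersetCard j Finset.univ, ∏ v ∈ S, p v ≤
      Real.exp (z * ∑ v, p v) := by
  calc _ = ∑ S ∈ Finset.powersetCard j Finset.univ, ∏ v ∈ S, z * p v := by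
        rw [Finset.mul_sum]
        refine Finset.sum_congr rfl fun S hS => ?_
        rw [Finset.prod_mul_distrib, Finset.prod_const, (Finset.mem_powersetCard.1 hS).2]
    _ ≤ ∑ S ∈ Finset.univ.powerset, ∏ v ∈ S, z * p v := by
        refine Finset.sum_le_sum_of_subset_of_nonneg
          (fun S _ => by simp) fun S _ _ => ?_
        exact Finset.prod_nonneg fun v _ => mul_nonneg hz (hp v)
    _ = ∏ v, (1 + z * p v) := by rw [Finset.prod_one_add]
    _ ≤ ∏ v, Real.exp (z * p v) := by
        refine Finset.prod_le_prod (fun v _ => ?_) fun v _ => ?_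
        · have := mul_nonneg hz (hp v); linarith
        · have := Real.add_one_le_exp (z * p v); linarith
    _ = _ := by rw [← Real.exp_sum, Finset.mul_sum]

/-! ### Systems of cherries -/

/-- The pairs in `R` whose second coordinate is shared with another pair in `R`. -/
def doubledPairs {α β : Type*} (R : Finset (α × β)) : Finset (α × β) :=
  R.filter fun p => ∃ x, x ≠ p.1 ∧ (x, p.2) ∈ R

/-- The pairs `(x, y), (x', y)` of the cherries `(x, x', y)` in `T`. -/
def cherryPairs {α β : Type*} (T : Finset (α × α × β)) : Finset (α × β) :=
  T.image (fun t => (t.1, t.2.2)) ∪ T.image (fun t => (t.2.1, t.2.2))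

lemma exists_cherries {α β : Type*} (m : ℕ) (R : Finset (α × β))
    (hR : 3 * m < (doubledPairs R).card + 3) :
    ∃ T : Finset (α × α × β), T.card = m ∧ cherryPairs T ⊆ R ∧
      (cherryPairs T).card = 2 * m := by
  induction m generalizing R with
  | zero => exact ⟨∅, by simp [cherryPairs]⟩
  | succ m ih =>
    have hne : (doubledPairs R).Nonempty := by
      rw [← Finset.card_pos]; omega
    obtain ⟨⟨x, y⟩, hp⟩ := hne
    simp only [doubledPairs, Finset.mem_filter] at hp
    obtain ⟨hxy, x', hx', hxy'⟩ := hp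
    set P : Finset (α × β) := {(x, y), (x', y)} with hP
    have hPcard : P.card = 2 := Finset.card_pair (by simp [hx'.symm])
    have hPR : P ⊆ R := by
      simp [hP, Finset.insert_subset_iff, hxy, hxy']
    set Z := (doubledPairs R \ doubledPairs (R \ P)) \ P with hZ
    have hZcard : Z.card ≤ 1 := by
      have hmem : ∀ p ∈ Z, p.2 = y ∧ p ∈ R \ P ∧ ∀ z, z ≠ p.1 → (z, p.2) ∉ R \ P := by
        rintro ⟨z, c⟩ hz
        simp only [hZ, doubledPairs, Finset.mem_sdiff, Finset.mem_filter] at hz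
        obtain ⟨⟨⟨h1, w, hw, hwR⟩, h2⟩, h3⟩ := hz
        have h4 : ∀ z', z' ≠ z → (z', c) ∉ R \ P := fun z' hz' hin =>
          h2 ⟨⟨h1, h3⟩, z', hz', Finset.mem_sdiff.1 hin⟩
        refine ⟨?_, Finset.mem_sdiff.2 ⟨h1, h3⟩, h4⟩
        have h5 := h4 w hw
        simp only [Finset.mem_sdiff, not_and, not_not] at h5
        have h6 := h5 hwR
        simp only [hP, Finset.mem_insert, Finset.mem_singleton, Prod.mk.injEq] at h6
        rcases h6 with h | h <;> exact h.2
      rw [Finset.card_le_one]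
      rintro ⟨z, c⟩ hz ⟨z', c'⟩ hz'
      obtain ⟨h1, h2, h3⟩ := hmem _ hz
      obtain ⟨h1', h2', h3'⟩ := hmem _ hz'
      simp only at h1 h1' h3
      subst h1 h1'
      by_contra hne
      exact h3 z' (fun h => hne (by rw [h])) h2'
    have hsub : doubledPairs R ⊆ doubledPairs (R \ P) ∪ (P ∪ Z) := by
      intro p hp
      simp only [hZ, Finset.mem_union, Finset.mem_sdiff]
      tauto
    have hcard := Finset.card_le_card hsub
    have u1 := Finset.card_union_le (doubledPairs (R \ P)) (P ∪ Z)
    have u2 := Finset.card_union_le P Z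
    obtain ⟨T, hT, hTR, hT2⟩ := ih (R \ P) (by omega)
    have hpairs : cherryPairs (insert (x, x', y) T) = P ∪ cherryPairs T := by
      ext p
      simp only [cherryPairs, hP, Finset.mem_union, Finset.image_insert, Finset.mem_insert,
        Finset.mem_singleton]
      tauto
    have hdisj : Disjoint P (cherryPairs T) :=
      Finset.disjoint_of_subset_right hTR Finset.disjoint_sdiff
    have hnot : (x, x', y) ∉ T := by
      intro h
      have h1 : (x, y) ∈ cherryPairs T :=
        Finset.mem_union_left _ (Finset.mem_image.2 ⟨_, h, rfl⟩)
      exact Finset.disjoint_left.1 hdisj (by simp [hP]) h1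
    refine ⟨insert (x, x', y) T, by rw [Finset.card_insert_of_notMem hnot, hT], ?_, ?_⟩
    · rw [hpairs]
      exact Finset.union_subset hPR (hTR.trans Finset.sdiff_subset)
    · rw [hpairs, Finset.card_union_of_disjoint hdisj, hPcard, hT2]
      ring

/-- The edges of the cherries in `T`. -/
def cherryEdges (T : Finset (Fin n × Fin n × Fin n)) : Finset (Sym2 (Fin n)) :=
  (cherryPairs T).image fun p => s(p.1, p.2)

/-- `K` contains `m` edge-disjoint cherries with all their endpoints in `S`. -/
def HasCherries (K : SimpleGraph (Fin n)) (S : Finset (Fin n)) (m : ℕ) : Prop :=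
  ∃ T ∈ Finset.powersetCard m (S ×ˢ S ×ˢ Finset.univ), (cherryEdges T).card = 2 * m ∧
    ∀ e ∈ cherryEdges T, e ∈ K.edgeSet

lemma exists_hasCherries {K : SimpleGraph (Fin n)} {U : Set (Fin n)} {m : ℕ} (hm : 0 < m)
    (h : 3 * m < E2count K U + 3) :
    ∃ S : Finset (Fin n), (S : Set (Fin n)) ⊆ U ∧ 0 < S.card ∧ S.card ≤ 2 * m ∧
      HasCherries K S m := by
  set R : Finset (Fin n × Fin n) :=
    Finset.univ.filter fun p => p.1 ∈ U ∧ p.2 ∉ U ∧ K.Adj p.1 p.2 with hR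
  have hE2 : E2count K U ≤ (doubledPairs R).card := by
    refine le_trans ?_ (Finset.card_image_le (f := fun p : Fin n × Fin n => s(p.1, p.2)))
    rw [E2count, ← Set.ncard_coe_finset]
    refine Set.ncard_le_ncard ?_ (Finset.finite_toSet _)
    rintro e ⟨he, x, y, rfl, hx, hy, x', hx', hne, hadj⟩
    rw [Finset.coe_image]
    refine ⟨(x, y), ?_, rfl⟩
    simp only [doubledPairs, hR, Finset.coe_filter, Finset.mem_filter, Finset.mem_univ,
      true_and, Set.mem_ofPred_eq]
    exact ⟨⟨hx, hy, he⟩, x', hne, hx', hy, hadj⟩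
  obtain ⟨T, hT, hTR, hT2⟩ := exists_cherries m R (by omega)
  have hmemR : ∀ p ∈ cherryPairs T, p.1 ∈ U ∧ p.2 ∉ U ∧ K.Adj p.1 p.2 := fun p hp => by
    simpa [hR] using hTR hp
  have h1 : ∀ t ∈ T, (t.1, t.2.2) ∈ cherryPairs T := fun t ht => by
    simp only [cherryPairs, Finset.mem_union, Finset.mem_image]
    exact Or.inl ⟨t, ht, rfl⟩
  have h2 : ∀ t ∈ T, (t.2.1, t.2.2) ∈ cherryPairs T := fun t ht => by
    simp only [cherryPairs, Finset.mem_union, Finset.mem_image]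
    exact Or.inr ⟨t, ht, rfl⟩
  refine ⟨T.image (fun t => t.1) ∪ T.image (fun t => t.2.1), ?_, ?_, ?_, T, ?_, ?_, ?_⟩
  · intro v hv
    simp only [Finset.coe_union, Finset.coe_image, Set.mem_union, Set.mem_image,
      Finset.mem_coe] at hv
    rcases hv with ⟨t, ht, rfl⟩ | ⟨t, ht, rfl⟩
    · exact (hmemR _ (h1 t ht)).1
    · exact (hmemR _ (h2 t ht)).1
  · obtain ⟨t, ht⟩ : T.Nonempty := by rw [← Finset.card_pos]; omega
    exact Finset.card_pos.2 ⟨t.1, Finset.mem_union_left _ (Finset.mem_image.2 ⟨t, ht, rfl⟩)⟩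
  · have u1 := Finset.card_union_le (T.image fun t => t.1) (T.image fun t => t.2.1)
    have u2 : (T.image fun t => t.1).card ≤ T.card := Finset.card_image_le
    have u3 : (T.image fun t => t.2.1).card ≤ T.card := Finset.card_image_le
    omega
  · refine Finset.mem_powersetCard.2 ⟨fun t ht => ?_, hT⟩
    simp only [Finset.mem_product, Finset.mem_univ, and_true, Finset.mem_union]
    exact ⟨Or.inl (Finset.mem_image.2 ⟨t, ht, rfl⟩), Or.inr (Finset.mem_image.2 ⟨t, ht, rfl⟩)⟩
  · rw [cherryEdges, Finset.card_image_of_injOn, hT2]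
    rintro ⟨x, y⟩ hp ⟨x', y'⟩ hp' heq
    obtain ⟨a1, a2, -⟩ := hmemR _ hp
    obtain ⟨b1, b2, -⟩ := hmemR _ hp'
    simp only [Sym2.eq_iff] at heq
    rcases heq with ⟨rfl, rfl⟩ | ⟨rfl, rfl⟩
    · rfl
    · exact absurd a1 b2
  · intro e he
    obtain ⟨p, hp, rfl⟩ := Finset.mem_image.1 he
    exact (hmemR p hp).2.2

lemma card_regular_hasCherries {d m : ℕ} (hd : 8 * (d + 1) ≤ n) (hm : 32 * m ≤ n * d)
    (S : Finset (Fin n)) :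
    (Finset.univ.filter fun K : SimpleGraph (Fin n) =>
      IsRegularGraph K d ∧ HasCherries K S m).card * n ^ (2 * m) ≤
      (S.card ^ 2 * n).choose m * (2 * d) ^ (2 * m) * (regularContaining n d ∅).card := by
  set P := (Finset.powersetCard m (S ×ˢ S ×ˢ (Finset.univ : Finset (Fin n)))).filter
    fun T => (cherryEdges T).card = 2 * m with hP
  have hPcard : P.card ≤ (S.card ^ 2 * n).choose m := by
    refine (Finset.card_filter_le _ _).trans ?_
    rw [Finset.card_powersetCard, Finset.card_product, Finset.card_product, Finset.card_univ,
      Fintype.card_fin, sq, mul_assoc]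
  have hsub : (Finset.univ.filter fun K : SimpleGraph (Fin n) =>
      IsRegularGraph K d ∧ HasCherries K S m) ⊆
      P.biUnion fun T => regularContaining n d (cherryEdges T) := by
    intro K hK
    simp only [Finset.mem_filter, Finset.mem_univ, true_and] at hK
    obtain ⟨hreg, T, hT, hT2, hTK⟩ := hK
    simp only [hP, Finset.mem_biUnion, Finset.mem_filter, regularContaining, Finset.mem_univ,
      true_and]
    exact ⟨T, ⟨hT, hT2⟩, hreg, hTK⟩
  calc _ ≤ (∑ T ∈ P, (regularContaining n d (cherryEdges T)).card) * n ^ (2 * m) := by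
        gcongr
        exact (Finset.card_le_card hsub).trans Finset.card_biUnion_le
    _ = ∑ T ∈ P, (regularContaining n d (cherryEdges T)).card * n ^ (2 * m) := by
        rw [Finset.sum_mul]
    _ ≤ ∑ _T ∈ P, (2 * d) ^ (2 * m) * (regularContaining n d ∅).card := by
        refine Finset.sum_le_sum fun T hT => ?_
        have hT2 : (cherryEdges T).card = 2 * m := (Finset.mem_filter.1 hT).2
        have := card_regularContaining hd (cherryEdges T) (by omega)
        rwa [hT2] at this
    _ = P.card * ((2 * d) ^ (2 * m) * (regularContaining n d ∅).card) := by
        rw [Finset.sum_const, smul_eq_mul]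
    _ ≤ _ := by
        rw [mul_assoc]
        gcongr

/-! ### First moment estimates -/

lemma card_small_sets_le (hn : 1 ≤ n) (w : ℝ) :
    ((Finset.univ.filter fun W : Finset (Fin n) => (W.card : ℝ) ≤ w).card : ℝ) ≤
      Real.exp (1 + w * Real.log n) := by
  have hn0 : (0 : ℝ) < n := by exact_mod_cast hn
  have hlog : 0 ≤ Real.log n := Real.log_nonneg (by exact_mod_cast hn)
  have hsum : ∑ W : Finset (Fin n), ((n : ℝ)⁻¹) ^ W.card ≤ Real.exp 1 := by
    have h := Finset.prod_one_add (f := fun _ : Fin n => ((n : ℝ)⁻¹)) Finset.univ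
    simp only [Finset.prod_const, Finset.powerset_univ, Finset.card_univ, Fintype.card_fin] at h
    rw [← h]
    calc (1 + (n : ℝ)⁻¹) ^ n ≤ Real.exp (n : ℝ)⁻¹ ^ n := by
          gcongr
          have := Real.add_one_le_exp (n : ℝ)⁻¹
          linarith
      _ = Real.exp 1 := by
          rw [← Real.exp_nat_mul, mul_inv_cancel₀ hn0.ne']
  calc _ = ∑ W : Finset (Fin n) with (W.card : ℝ) ≤ w, (1 : ℝ) := by simp
    _ ≤ ∑ W : Finset (Fin n) with (W.card : ℝ) ≤ w,
        Real.exp (w * Real.log n) * ((n : ℝ)⁻¹) ^ W.card := by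
        refine Finset.sum_le_sum fun W hW => ?_
        have hW' : (W.card : ℝ) ≤ w := (Finset.mem_filter.1 hW).2
        have : ((n : ℝ)⁻¹) ^ W.card = Real.exp (-(W.card * Real.log n)) := by
          rw [Real.exp_neg, Real.exp_nat_mul, Real.exp_log hn0, inv_pow]
        rw [this, ← Real.exp_add]
        apply Real.one_le_exp
        nlinarith
    _ ≤ ∑ W : Finset (Fin n), Real.exp (w * Real.log n) * ((n : ℝ)⁻¹) ^ W.card :=
        Finset.sum_le_sum_of_subset_of_nonneg (Finset.subset_univ _) fun W _ _ => by positivity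
    _ ≤ Real.exp (w * Real.log n) * Real.exp 1 := by
        rw [← Finset.mul_sum]
        gcongr
    _ = _ := by rw [← Real.exp_add, add_comm]

lemma choose_le_pow_mul_exp (N : ℕ) {m : ℕ} (hm : 0 < m) :
    (N.choose m : ℝ) ≤ (N * Real.exp 1 / m) ^ m := by
  have hm0 : (0 : ℝ) < m := by exact_mod_cast hm
  have h1 : (N.choose m : ℝ) ≤ (N : ℝ) ^ m / m.factorial := Nat.choose_le_pow_div m N
  have h2 := Real.pow_div_factorial_le_exp m hm0.le m
  have hf : (0 : ℝ) < m.factorial := by exact_mod_cast m.factorial_pos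
  refine h1.trans ?_
  rw [div_pow, mul_pow, ← Real.exp_nat_mul, mul_one]
  rw [div_le_iff₀ hf] at h2 ⊢
  rw [div_mul_eq_mul_div, le_div_iff₀ (by positivity), mul_assoc]
  gcongr

lemma exp_one_pow_six_le : Real.exp 1 ^ 6 ≤ 406 := by
  have h := Real.exp_one_lt_d9.le
  calc Real.exp 1 ^ 6 ≤ (2.72 : ℝ) ^ 6 := by
        gcongr
        linarith
    _ ≤ 406 := by norm_num

/-- The numerical core of the first moment estimate. -/
lemma first_moment_numeric {N d u m j lam : ℝ} {mn jn : ℕ} (hmn : m = mn)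
    (hN : 0 < N) (hd : 0 < d) (hlam : 0 < lam) (hj : 1 ≤ j) (hju : j ≤ u) (hjm : jn ≤ 2 * mn)
    (hu : u ≤ lam * N / (10 ^ 6 * d)) (hm : lam * d * u / 6 ≤ m) :
    (8 * u / j) ^ jn * Real.exp (2 * m) * ((j ^ 2 * N * Real.exp 1 / m) ^ mn *
      (2 * d / N) ^ (2 * mn)) ≤ Real.exp (-(3 * m)) := by
  have hu0 : 0 < u := by linarith
  have hm0 : 0 < m := lt_of_lt_of_le (by positivity) hm
  have hj0 : 0 < j := by linarith
  have h1 : (8 * u / j) ^ jn ≤ (8 * u / j) ^ (2 * mn) := by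
    refine pow_le_pow_right₀ ?_ hjm
    rw [le_div_iff₀ hj0]
    linarith
  have hexp2 : Real.exp (2 * m) = (Real.exp 1 ^ 2) ^ mn := by
    rw [← pow_mul, ← Real.exp_nat_mul, hmn]
    push_cast
    ring_nf
  have hexp3 : Real.exp (-(3 * m)) = ((Real.exp 1 ^ 3)⁻¹) ^ mn := by
    rw [inv_pow, ← pow_mul, ← Real.exp_nat_mul, ← Real.exp_neg, hmn]
    push_cast
    ring_nf
  rw [hexp3, hexp2]
  calc _ ≤ (8 * u / j) ^ (2 * mn) * (Real.exp 1 ^ 2) ^ mn *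
        ((j ^ 2 * N * Real.exp 1 / m) ^ mn * (2 * d / N) ^ (2 * mn)) := by gcongr
    _ = ((8 * u / j) ^ 2 * Real.exp 1 ^ 2 * ((j ^ 2 * N * Real.exp 1 / m) *
        (2 * d / N) ^ 2)) ^ mn := by
        rw [pow_mul, pow_mul (2 * d / N)]
        simp only [mul_pow]
    _ ≤ _ := by
        refine pow_le_pow_left₀ (by positivity) ?_ mn
        have heq : (8 * u / j) ^ 2 * Real.exp 1 ^ 2 * ((j ^ 2 * N * Real.exp 1 / m) *
            (2 * d / N) ^ 2) = 256 * Real.exp 1 ^ 3 * (u ^ 2 * d ^ 2) / (N * m) := by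
          field_simp
          ring
        rw [heq, ← one_div, div_le_div_iff₀ (by positivity) (by positivity)]
        have h6 := exp_one_pow_six_le
        rw [le_div_iff₀ (by positivity)] at hu
        have hud : u ^ 2 * d ^ 2 * 10 ^ 6 ≤ u * d * (lam * N) := by
          have : 0 ≤ u * d := by positivity
          nlinarith
        have hNm : N * (lam * d * u / 6) ≤ N * m := by gcongr
        calc 256 * Real.exp 1 ^ 3 * (u ^ 2 * d ^ 2) * Real.exp 1 ^ 3
            = 256 * Real.exp 1 ^ 6 * (u ^ 2 * d ^ 2) := by ring
          _ ≤ 256 * 406 * (u ^ 2 * d ^ 2) := by gcongr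
          _ ≤ 1 * (N * m) := by nlinarith

/-- The probability of `K` under the uniform distribution on `d`-regular graphs. -/
def regWeight (d : ℕ) (K : SimpleGraph (Fin n)) : ℝ :=
  if IsRegularGraph K d then ((regularContaining n d ∅).card : ℝ)⁻¹ else 0

lemma regWeight_nonneg (d : ℕ) (K : SimpleGraph (Fin n)) : 0 ≤ regWeight d K := by
  unfold regWeight
  positivity

lemma sum_regWeight_hasCherries_le {d m : ℕ} (hd : 8 * (d + 1) ≤ n) (hm : 32 * m ≤ n * d)
    (S : Finset (Fin n)) :
    ∑ K : SimpleGraph (Fin n) with HasCherries K S m, regWeight d K ≤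
      (S.card ^ 2 * n).choose m * (2 * d / n : ℝ) ^ (2 * m) := by
  have h := card_regular_hasCherries hd hm S
  have hn0 : (0 : ℝ) < n := by
    have : 0 < n := by omega
    exact_mod_cast this
  have heq : ∑ K : SimpleGraph (Fin n) with HasCherries K S m, regWeight d K =
      (Finset.univ.filter fun K : SimpleGraph (Fin n) =>
        IsRegularGraph K d ∧ HasCherries K S m).card *
        ((regularContaining n d ∅).card : ℝ)⁻¹ := by
    simp only [regWeight]
    rw [← Finset.sum_filter, Finset.sum_const, Finset.filter_filter, nsmul_eq_mul]
    simp only [and_comm]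
  rw [heq]
  rcases Nat.eq_zero_or_pos (regularContaining n d ∅).card with h0 | h0
  · rw [h0]
    simp only [Nat.cast_zero, inv_zero, mul_zero]
    positivity
  · have h0' : (0 : ℝ) < (regularContaining n d ∅).card := by exact_mod_cast h0
    rw [← div_eq_mul_inv, div_le_iff₀ h0', div_pow, mul_div_assoc', div_mul_eq_mul_div,
      le_div_iff₀ (by positivity)]
    exact_mod_cast h

lemma sum_covers_le {δ : ℝ} (hn : 1 ≤ n) (hδ : 0 < δ) {u j : ℕ} (hj : 1 ≤ j) (hju : j ≤ u)
    {W : Finset (Fin n)} (hW : (W.card : ℝ) ≤ 4 * u / δ) :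
    ∑ S ∈ Finset.powersetCard j Finset.univ,
      ∏ v ∈ S, (if v ∈ W then 1 else W.card * (2 * δ / n)) ≤
      (8 * u / j : ℝ) ^ j * Real.exp (4 * u / δ + j) := by
  have hn0 : (0 : ℝ) < n := by exact_mod_cast hn
  have hj0 : (0 : ℝ) < j := by exact_mod_cast hj
  have hju' : (j : ℝ) ≤ u := by exact_mod_cast hju
  have hu0 : (0 : ℝ) < u := by linarith
  have h := pow_mul_sum_powersetCard_prod_le
    (p := fun v => if v ∈ W then (1 : ℝ) else W.card * (2 * δ / n))
    (fun v => by positivity) (z := j / (8 * u)) (by positivity) j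
  have hsum : ∑ v, (if v ∈ W then (1 : ℝ) else W.card * (2 * δ / n)) ≤ 4 * u / δ + 8 * u := by
    calc _ ≤ ∑ v, ((if v ∈ W then (1 : ℝ) else 0) + W.card * (2 * δ / n)) := by
          refine Finset.sum_le_sum fun v _ => ?_
          have : (0 : ℝ) ≤ W.card * (2 * δ / n) := by positivity
          split_ifs <;> linarith
      _ = W.card + 2 * (W.card * δ) := by
          rw [Finset.sum_add_distrib, Finset.sum_const, Finset.card_univ, Fintype.card_fin,
            nsmul_eq_mul]
          simp only [Finset.sum_ite_mem, Finset.univ_inter, Finset.sum_const, nsmul_eq_mul,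
            mul_one]
          field_simp
      _ ≤ _ := by
          have := (le_div_iff₀ hδ).1 hW
          linarith
  have hz1 : (j : ℝ) / (8 * u) ≤ 1 := by
    rw [div_le_one (by positivity)]
    linarith
  have hexp : Real.exp (j / (8 * u) *
      ∑ v, (if v ∈ W then (1 : ℝ) else W.card * (2 * δ / n))) ≤ Real.exp (4 * u / δ + j) := by
    rw [Real.exp_le_exp]
    calc _ ≤ (j : ℝ) / (8 * u) * (4 * u / δ + 8 * u) := by gcongr
      _ = (j : ℝ) / (8 * u) * (4 * u / δ) + j := by field_simp
      _ ≤ 1 * (4 * u / δ) + j := by gcongr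
      _ = _ := by ring
  have h' := h.trans hexp
  have hinv : (8 * u / j : ℝ) ^ j * (j / (8 * u)) ^ j = 1 := by
    rw [← mul_pow, div_mul_div_cancel₀ hj0.ne', div_self (by positivity), one_pow]
  calc _ = (8 * u / j : ℝ) ^ j * ((j / (8 * u)) ^ j * ∑ S ∈ Finset.powersetCard j Finset.univ,
        ∏ v ∈ S, (if v ∈ W then 1 else W.card * (2 * δ / n))) := by
        rw [← mul_assoc, hinv, one_mul]
    _ ≤ _ := by gcongr

/-- The pairs `(K, F)` for which some `W` of size at most `w` and some `j`-set
`S ⊆ W ∪ N_F(W)` are such that `K` has `m` edge-disjoint cherries with endpoints in `S`. -/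
def cherryEvent (n : ℕ) (w : ℝ) (j m : ℕ) : Finset (SimpleGraph (Fin n) × SimpleGraph (Fin n)) :=
  (Finset.univ.filter fun W : Finset (Fin n) => (W.card : ℝ) ≤ w).biUnion fun W =>
    (Finset.powersetCard j Finset.univ).biUnion fun S =>
      (Finset.univ.filter fun K => HasCherries K S m) ×ˢ
        (Finset.univ.filter fun F => (S : Set (Fin n)) ⊆ W ∪ nbhd F W)

lemma sum_cherryEvent_le {d u j m : ℕ} {lam δ : ℝ} (hn : 3 ≤ n) (hd0 : 0 < d)
    (hd : 8 * (d + 1) ≤ n) (hmn : 32 * m ≤ n * d) (hlam : 0 < lam) (hδ : 0 < δ)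
    (hδ1 : 2 * δ / n ≤ 1) (hj : 1 ≤ j) (hju : j ≤ u) (hjm : j ≤ 2 * m)
    (hu : (u : ℝ) ≤ lam * n / (10 ^ 6 * d)) (hm : lam * d * u / 6 ≤ m) :
    ∑ w ∈ cherryEvent n (4 * u / δ) j m, regWeight d w.1 * gnpWeight (2 * δ / n) w.2 ≤
      Real.exp (1 + 2 * (4 * u / δ * Real.log n) - 3 * m) := by
  have hn0 : (0 : ℝ) < n := by
    have : 0 < n := by omega
    exact_mod_cast this
  have hn3 : (3 : ℝ) ≤ n := by exact_mod_cast hn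
  have hq0 : 0 ≤ 2 * δ / n := by positivity
  have hm0 : 0 < m := by omega
  have hlog : 1 ≤ Real.log n := by
    rw [Real.le_log_iff_exp_le hn0]
    have := Real.exp_one_lt_d9
    linarith
  have hw : ∀ w : SimpleGraph (Fin n) × SimpleGraph (Fin n),
      0 ≤ regWeight d w.1 * gnpWeight (2 * δ / n) w.2 := fun w =>
    mul_nonneg (regWeight_nonneg d _) (gnpWeight_nonneg hq0 hδ1 _)
  set B : ℝ := (j ^ 2 * n * Real.exp 1 / m : ℝ) ^ m * (2 * d / n : ℝ) ^ (2 * m) with hB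
  have hB0 : 0 ≤ B := by positivity
  have hnum := first_moment_numeric (N := n) (d := d) (u := u) (m := m) (j := j) (lam := lam)
    rfl hn0 (by exact_mod_cast hd0) hlam (by exact_mod_cast hj) (by exact_mod_cast hju) hjm
    hu hm
  have hSW : ∀ W : Finset (Fin n), ∀ S ∈ Finset.powersetCard j (Finset.univ : Finset (Fin n)),
      ∑ w ∈ (Finset.univ.filter fun K => HasCherries K S m) ×ˢ
        (Finset.univ.filter fun F => (S : Set (Fin n)) ⊆ W ∪ nbhd F W),
        regWeight d w.1 * gnpWeight (2 * δ / n) w.2 ≤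
      B * ∏ v ∈ S, (if v ∈ W then 1 else W.card * (2 * δ / n)) := by
    intro W S hS
    rw [Finset.sum_product, ← Finset.sum_mul_sum]
    refine mul_le_mul ?_ (sum_gnpWeight_covers_le hq0 hδ1 W S)
      (Finset.sum_nonneg fun F _ => gnpWeight_nonneg hq0 hδ1 F) hB0
    refine (sum_regWeight_hasCherries_le hd hmn S).trans ?_
    rw [(Finset.mem_powersetCard.1 hS).2, hB]
    gcongr
    have := choose_le_pow_mul_exp (j ^ 2 * n) hm0
    push_cast at this
    exact this
  have hWbound : ∀ W ∈ (Finset.univ.filter fun W : Finset (Fin n) =>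
      (W.card : ℝ) ≤ 4 * u / δ),
      ∑ w ∈ (Finset.powersetCard j (Finset.univ : Finset (Fin n))).biUnion fun S =>
        (Finset.univ.filter fun K => HasCherries K S m) ×ˢ
        (Finset.univ.filter fun F => (S : Set (Fin n)) ⊆ W ∪ nbhd F W),
        regWeight d w.1 * gnpWeight (2 * δ / n) w.2 ≤
      Real.exp (4 * u / δ - 3 * m) := by
    intro W hW
    refine (sum_biUnion_le _ _ hw).trans ((Finset.sum_le_sum (hSW W)).trans ?_)
    rw [← Finset.mul_sum]
    have hc := sum_covers_le (by omega) hδ hj hju (Finset.mem_filter.1 hW).2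
    have hj2 : (j : ℝ) ≤ 2 * m := by exact_mod_cast hjm
    calc _ ≤ B * ((8 * u / j : ℝ) ^ j * Real.exp (4 * u / δ + j)) := by gcongr
      _ ≤ B * ((8 * u / j : ℝ) ^ j * Real.exp (4 * u / δ + 2 * m)) := by gcongr
      _ = Real.exp (4 * u / δ) * ((8 * u / j) ^ j * Real.exp (2 * m) * B) := by
          rw [Real.exp_add]; ring
      _ ≤ Real.exp (4 * u / δ) * Real.exp (-(3 * m)) := by gcongr
      _ = _ := by rw [← Real.exp_add, sub_eq_add_neg]
  refine (sum_biUnion_le _ _ hw).trans ((Finset.sum_le_sum hWbound).trans ?_)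
  rw [Finset.sum_const, nsmul_eq_mul]
  calc _ ≤ Real.exp (1 + 4 * u / δ * Real.log n) * Real.exp (4 * u / δ - 3 * m) := by
        gcongr
        exact card_small_sets_le (by omega) _
    _ ≤ _ := by
        rw [← Real.exp_add, Real.exp_le_exp]
        have : (4 * u / δ : ℝ) * 1 ≤ 4 * u / δ * Real.log n := by gcongr
        linarith

/-- The pairs `(K, F)` violating the expansion property of the sets `U` that are covered by
few `F`-neighbourhoods. -/
def expansionFails (n d : ℕ) (lam δ : ℝ) : Finset (SimpleGraph (Fin n) × SimpleGraph (Fin n)) :=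
  Finset.univ.filter fun w => ¬ ∀ U : Set (Fin n), (U.ncard : ℝ) ≤ lam * n / (10 ^ 6 * d) →
    (∃ W : Set (Fin n), (W.ncard : ℝ) ≤ 4 * U.ncard / δ ∧ U ⊆ W ∪ nbhd w.2 W) →
      (E2count w.1 U : ℝ) ≤ lam * d / 2 * U.ncard

/-- The sizes `u` for which a set of size `u` can violate the expansion property. -/
def admissibleSizes (n d : ℕ) (lam δ : ℝ) : Finset ℕ :=
  (Finset.Icc 1 n).filter fun u => (u : ℝ) ≤ lam * n / (10 ^ 6 * d) ∧ δ ≤ 4 * u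

lemma expansionFails_subset {d : ℕ} {lam δ : ℝ} (hd : 0 < d) (hlam : 0 < lam) (hδ : 0 < δ) :
    expansionFails n d lam δ ⊆ (admissibleSizes n d lam δ).biUnion fun u =>
      ((Finset.Icc 1 n).filter fun j => j ≤ u ∧ j ≤ 2 * ⌈lam * d * u / 6⌉₊).biUnion fun j =>
        cherryEvent n (4 * u / δ) j ⌈lam * d * u / 6⌉₊ := by
  rintro ⟨K, F⟩ hw
  simp only [expansionFails, Finset.mem_filter, Finset.mem_univ, true_and] at hw
  push Not at hw
  obtain ⟨U, hU, ⟨W, hW, hUW⟩, hbad⟩ := hw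
  have hd' : (0 : ℝ) < d := by exact_mod_cast hd
  have hUne : U.Nonempty := by
    by_contra hne
    rw [Set.not_nonempty_iff_eq_empty] at hne
    subst hne
    simp [E2count] at hbad
  have hWne : W.Nonempty := by
    obtain ⟨v, hv⟩ := hUne
    rcases hUW hv with h | ⟨-, w, h, -⟩
    · exact ⟨v, h⟩
    · exact ⟨w, h⟩
  have hWcard : (1 : ℝ) ≤ W.ncard := by
    exact_mod_cast (Set.ncard_pos (Set.toFinite W)).2 hWne
  have hUcard : 1 ≤ U.ncard := (Set.ncard_pos (Set.toFinite U)).2 hUne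
  have hUcard' : (1 : ℝ) ≤ U.ncard := by exact_mod_cast hUcard
  have hcardle : ∀ X : Set (Fin n), X.ncard ≤ n := fun X => by
    simpa using Set.ncard_le_card X
  set u := U.ncard with hu
  set m := ⌈lam * d * u / 6⌉₊ with hm
  have hmpos : 0 < m := Nat.ceil_pos.2 (by positivity)
  have hmlt : (m : ℝ) < lam * d * u / 6 + 1 := Nat.ceil_lt_add_one (by positivity)
  have h3m : 3 * m < E2count K U + 3 := by
    have : (3 * m : ℝ) < E2count K U + 3 := by linarith
    exact_mod_cast this
  obtain ⟨S, hSU, hS0, hS2, hSK⟩ := exists_hasCherries hmpos h3m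
  have hScard : S.card ≤ u := by
    rw [← Set.ncard_coe_finset]
    exact Set.ncard_le_ncard hSU
  simp only [Finset.mem_biUnion, admissibleSizes, Finset.mem_filter, Finset.mem_Icc, cherryEvent,
    Finset.mem_product, Finset.mem_univ, true_and, Finset.mem_powersetCard]
  refine ⟨u, ⟨⟨hUcard, hcardle U⟩, hU, ?_⟩, S.card, ⟨⟨hS0, hScard.trans (hcardle U)⟩, hScard, hS2⟩,
    W.toFinset, ?_, S, ⟨Finset.subset_univ _, rfl⟩, hSK, ?_⟩
  · have := (le_div_iff₀ hδ).1 (hWcard.trans hW)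
    linarith
  · rwa [← Set.ncard_eq_toFinset_card']
  · rw [Set.coe_toFinset]
    exact hSU.trans hUW

lemma sum_expansionFails_le {d : ℕ} {lam δ : ℝ} (hn : 40 ≤ n) (hlam : 0 < lam) (hlam1 : lam ≤ 1)
    (hd : 240 * Real.log n ≤ d) (hdn : (d : ℝ) ≤ n / 240) (hδ : 0 < δ) (hδ1 : 2 * δ / n ≤ 1)
    (hld : 240 * Real.log n ≤ lam * δ * d) :
    ∑ w ∈ expansionFails n d lam δ, regWeight d w.1 * gnpWeight (2 * δ / n) w.2 ≤
      3 / (n : ℝ) ^ 18 := by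
  have hn' : (40 : ℝ) ≤ n := by exact_mod_cast hn
  have hn0 : (0 : ℝ) < n := by linarith
  have hlog : 1 ≤ Real.log n := by
    rw [Real.le_log_iff_exp_le hn0]
    have := Real.exp_one_lt_d9
    linarith
  have hdpos : (0 : ℝ) < d := by linarith
  have hd0 : 0 < d := by exact_mod_cast hdpos
  have hd1 : (1 : ℝ) ≤ d := by exact_mod_cast hd0
  have hd8 : 8 * (d + 1) ≤ n := by
    have : (8 * (d + 1) : ℝ) ≤ n := by linarith
    exact_mod_cast this
  have hw : ∀ w : SimpleGraph (Fin n) × SimpleGraph (Fin n),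
      0 ≤ regWeight d w.1 * gnpWeight (2 * δ / n) w.2 := fun w =>
    mul_nonneg (regWeight_nonneg d _) (gnpWeight_nonneg (by positivity) hδ1 _)
  have hterm : ∀ u ∈ admissibleSizes n d lam δ,
      ∀ j ∈ (Finset.Icc 1 n).filter fun j => j ≤ u ∧ j ≤ 2 * ⌈lam * d * u / 6⌉₊,
      ∑ w ∈ cherryEvent n (4 * u / δ) j ⌈lam * d * u / 6⌉₊,
        regWeight d w.1 * gnpWeight (2 * δ / n) w.2 ≤ 3 / (n : ℝ) ^ 20 := by
    intro u hu j hj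
    simp only [admissibleSizes, Finset.mem_filter, Finset.mem_Icc] at hu hj
    obtain ⟨⟨hu1, -⟩, hule, huδ⟩ := hu
    obtain ⟨⟨hj1, -⟩, hju, hjm⟩ := hj
    have hu0 : (0 : ℝ) < u := by exact_mod_cast hu1
    set m := ⌈lam * d * u / 6⌉₊ with hmdef
    have hm : lam * d * u / 6 ≤ m := Nat.le_ceil _
    have hmlt : (m : ℝ) < lam * d * u / 6 + 1 := Nat.ceil_lt_add_one (by positivity)
    have hmn : 32 * m ≤ n * d := by
      have h1 : d * u * 10 ^ 6 ≤ lam * n := by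
        have := (le_div_iff₀ (by positivity)).1 hule
        linarith
      have h2 : lam * (d * u) ≤ 1 * (d * u) := by gcongr
      have h3 : lam * n ≤ 1 * n := by gcongr
      have h4 : (n : ℝ) * 1 ≤ n * d := by gcongr
      have : (32 * m : ℝ) ≤ n * d := by linarith
      exact_mod_cast this
    refine (sum_cherryEvent_le (by omega) hd0 hd8 hmn hlam hδ hδ1 hj1 hju hjm hule hm).trans ?_
    have h5 : 4 * u / δ * Real.log n ≤ m / 10 := by
      rw [div_mul_eq_mul_div, div_le_iff₀ hδ]
      have : (u : ℝ) * (240 * Real.log n) ≤ u * (lam * δ * d) := by gcongr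
      have : δ * (lam * d * u / 6) ≤ δ * m := by gcongr
      linarith
    have h6 : 10 * Real.log n ≤ m := by
      have : lam * d * δ ≤ lam * d * (4 * u) := by gcongr
      linarith
    have h7 : Real.exp (1 + 2 * (4 * u / δ * Real.log n) - 3 * m) ≤
        Real.exp (1 + -(20 * Real.log n)) := by
      rw [Real.exp_le_exp]
      linarith
    refine h7.trans ?_
    have h8 : Real.exp (-(20 * Real.log n)) = ((n : ℝ) ^ 20)⁻¹ := by
      rw [Real.exp_neg, ← Real.exp_log (pow_pos hn0 20), Real.log_pow]
      norm_num
    rw [Real.exp_add, h8, div_eq_mul_inv]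
    have := Real.exp_one_lt_d9
    gcongr
    linarith
  have hcard : ∀ s ⊆ Finset.Icc 1 n, s.card ≤ n := fun s hs => by
    simpa using Finset.card_le_card hs
  calc _ ≤ ∑ w ∈ (admissibleSizes n d lam δ).biUnion fun u =>
        ((Finset.Icc 1 n).filter fun j => j ≤ u ∧ j ≤ 2 * ⌈lam * d * u / 6⌉₊).biUnion fun j =>
          cherryEvent n (4 * u / δ) j ⌈lam * d * u / 6⌉₊,
        regWeight d w.1 * gnpWeight (2 * δ / n) w.2 :=
        Finset.sum_le_sum_of_subset_of_nonneg (expansionFails_subset hd0 hlam hδ)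
          fun w _ _ => hw w
    _ ≤ ∑ u ∈ admissibleSizes n d lam δ,
        ∑ j ∈ (Finset.Icc 1 n).filter fun j => j ≤ u ∧ j ≤ 2 * ⌈lam * d * u / 6⌉₊,
          3 / (n : ℝ) ^ 20 := by
        refine (sum_biUnion_le _ _ hw).trans (Finset.sum_le_sum fun u hu => ?_)
        exact (sum_biUnion_le _ _ hw).trans (Finset.sum_le_sum (hterm u hu))
    _ ≤ ∑ u ∈ admissibleSizes n d lam δ, n * (3 / (n : ℝ) ^ 20) := by
        refine Finset.sum_le_sum fun u _ => ?_
        rw [Finset.sum_const, nsmul_eq_mul]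
        gcongr
        exact hcard _ (Finset.filter_subset _ _)
    _ ≤ n * (n * (3 / (n : ℝ) ^ 20)) := by
        rw [Finset.sum_const, nsmul_eq_mul]
        gcongr
        exact hcard _ (Finset.filter_subset _ _)
    _ = _ := by field_simp

lemma prEvent_add_prEvent_not {α : Type*} (μ : PMF α) (P : α → Prop) :
    prEvent μ P + prEvent μ (fun a => ¬ P a) = 1 := by
  rw [prEvent, prEvent, ← ENNReal.tsum_add, ← μ.tsum_coe]
  refine tsum_congr fun a => ?_
  by_cases h : P a <;> simp [h]

lemma IsRegIndepGnp.apply_eq {ν : PMF (SimpleGraph (Fin n) × SimpleGraph (Fin n))} {d : ℕ}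
    {q : ℝ} (hν : IsRegIndepGnp ν d q) (w : SimpleGraph (Fin n) × SimpleGraph (Fin n)) :
    ν w = ENNReal.ofReal (regWeight d w.1 * gnpWeight q w.2) := by
  rw [hν w, ENNReal.ofReal_mul (regWeight_nonneg d _), gnpWeight, regWeight]
  congr 1
  split_ifs with h
  · have hcard : {G : SimpleGraph (Fin n) | IsRegularGraph G d}.ncard =
        (regularContaining n d ∅).card := by
      rw [← Set.ncard_coe_finset]
      congr 1
      ext G
      simp [regularContaining]
    have hpos : 0 < (regularContaining n d ∅).card :=
      Finset.card_pos.2 ⟨w.1, by simpa [regularContaining] using h⟩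
    rw [hcard, ENNReal.ofReal_inv_of_pos (by exact_mod_cast hpos), ENNReal.ofReal_natCast]
  · simp

/-- **Lemma 6.4.** There are absolute constants `c* > 0` and `C* ≥ 1` such that for every
`c > 0` and all sufficiently large `n`: with `(log n)⁻⁴ ≤ λ ≤ c*`, `C* log n ≤ d ≤ n/C*`,
`dn` even, `δ > 0` with `λδd ≥ C* log n`, `q = 2δ/n`, and `(K,F)` an independent pair with
`K ~ G_d(n)`, `F ~ G(n,q)`, with probability at least `1 − c n⁻¹⁴`: for each `U ⊆ [n]`, if
`|U| ≤ λn/(10⁶ d)` and there is `W` with `|W| ≤ 4|U|/δ` and `U ⊆ W ∪ N_F(W)`, then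
`|E_{≥2,K}(U)| ≤ (λd/2)|U|`. -/
theorem regular_expansion_E2 :
    ∃ cstar Cstar : ℝ, 0 < cstar ∧ 1 ≤ Cstar ∧
      ∀ c : ℝ, 0 < c →
        ∃ n₀ : ℕ, ∀ n : ℕ, n₀ ≤ n →
          ∀ lam δ : ℝ, ∀ d : ℕ,
            ((Real.log n) ^ 4)⁻¹ ≤ lam → lam ≤ cstar →
            Cstar * Real.log n ≤ (d : ℝ) → (d : ℝ) ≤ (n : ℝ) / Cstar → Even (d * n) →
            0 < δ → Cstar * Real.log n ≤ lam * δ * d →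
            ∀ ν : PMF (SimpleGraph (Fin n) × SimpleGraph (Fin n)),
              IsRegIndepGnp ν d (2 * δ / n) →
              ENNReal.ofReal (1 - c / (n : ℝ) ^ 14) ≤
                prEvent ν (fun w =>
                  ∀ U : Set (Fin n), (U.ncard : ℝ) ≤ lam * n / (10 ^ 6 * d) →
                    (∃ W : Set (Fin n), (W.ncard : ℝ) ≤ 4 * U.ncard / δ ∧
                        U ⊆ W ∪ nbhd w.2 W) →
                      (E2count w.1 U : ℝ) ≤ lam * d / 2 * U.ncard) := by
  refine ⟨1, 240, one_pos, by norm_num, fun c hc => ⟨max 40 ⌈3 / c⌉₊, ?_⟩⟩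
  intro n hn lam δ d hlam hlam1 hd hdn _ hδ hld ν hν
  have hn40 : 40 ≤ n := (le_max_left _ _).trans hn
  have hn' : (40 : ℝ) ≤ n := by exact_mod_cast hn40
  have hn0 : (0 : ℝ) < n := by linarith
  have hnc : 3 / c ≤ n := Nat.ceil_le.1 ((le_max_right _ _).trans hn)
  have hlog : 0 < Real.log n := Real.log_pos (by linarith)
  have hlam0 : 0 < lam := lt_of_lt_of_le (by positivity) hlam
  have hdpos : (0 : ℝ) < d := by linarith
  have hd0 : 0 < d := by exact_mod_cast hdpos
  set P : SimpleGraph (Fin n) × SimpleGraph (Fin n) → Prop := fun w =>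
    ∀ U : Set (Fin n), (U.ncard : ℝ) ≤ lam * n / (10 ^ 6 * d) →
      (∃ W : Set (Fin n), (W.ncard : ℝ) ≤ 4 * U.ncard / δ ∧ U ⊆ W ∪ nbhd w.2 W) →
        (E2count w.1 U : ℝ) ≤ lam * d / 2 * U.ncard with hP
  have hnot : prEvent ν (fun w => ¬ P w) = ∑ w ∈ expansionFails n d lam δ, ν w := by
    rw [prEvent, tsum_fintype, expansionFails, Finset.sum_filter]
    refine Finset.sum_congr rfl fun w _ => ?_
    by_cases h : P w
    · rw [if_neg (not_not.2 h), if_neg (not_not.2 h)]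
    · rw [if_pos h, if_pos h]
  have hbad : prEvent ν (fun w => ¬ P w) ≤ ENNReal.ofReal (c / (n : ℝ) ^ 14) := by
    rw [hnot]
    by_cases hq : 2 * δ / n ≤ 1
    · simp only [hν.apply_eq]
      rw [← ENNReal.ofReal_sum_of_nonneg fun w _ =>
        mul_nonneg (regWeight_nonneg d _) (gnpWeight_nonneg (by positivity) hq _)]
      refine ENNReal.ofReal_le_ofReal
        ((sum_expansionFails_le hn40 hlam0 hlam1 hd hdn hδ hq hld).trans ?_)
      rw [div_le_div_iff₀ (by positivity) (by positivity)]
      have h3 : 3 ≤ c * n := by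
        rw [div_le_iff₀ hc] at hnc
        linarith
      have h4 : (n : ℝ) ≤ (n : ℝ) ^ 4 := le_self_pow₀ (by linarith) (by norm_num)
      calc 3 * (n : ℝ) ^ 14 ≤ c * n * (n : ℝ) ^ 14 := by gcongr
        _ ≤ c * (n : ℝ) ^ 4 * (n : ℝ) ^ 14 := by gcongr
        _ = c * (n : ℝ) ^ 18 := by ring
    · have hempty : admissibleSizes n d lam δ = ∅ := by
        refine Finset.filter_false_of_mem fun u _ hu => hq ?_
        rw [le_div_iff₀ (by positivity)] at hu
        rw [div_le_one hn0]
        have hd1 : (1 : ℝ) ≤ d := by exact_mod_cast hd0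
        have h1 : (u : ℝ) * (10 ^ 6 * 1) ≤ u * (10 ^ 6 * d) := by gcongr
        have h2 : lam * n ≤ 1 * n := by gcongr
        linarith [hu.1, hu.2]
      have hsub := expansionFails_subset (n := n) hd0 hlam0 hδ
      rw [hempty, Finset.biUnion_empty, Finset.subset_empty] at hsub
      rw [hsub, Finset.sum_empty]
      exact zero_le
  rw [ENNReal.ofReal_sub _ (by positivity), ENNReal.ofReal_one,
    ← prEvent_add_prEvent_not ν P, tsub_le_iff_right]
  gcongr

end Sandwich
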